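/- Let R > 1 and let T : L²(S²) → L¹(S²) be the satellite gradiometry operator (T f)(x) := Σ_{m=0}^∞ ((m+1)(m+2)/R^{m+3})·(Q_m f)(x). Then there exist δ₀ > 0 (possibly depending on R) and a constant C > 0 independent of R and δ such that for all 0 < δ ≤ δ₀ and all f ∈ L²(S²): ‖Tf‖_{L∞(S²)} ≤ C·δ^{−5/2}·R^{−√(4π/δ)−4}·‖f‖_{L²(S²)} + (1/δ)·‖Tf‖_{L¹(S²)}. -/

import Mathlib

open scoped Real ENNReal
open MeasureTheory

noncomputable section

/-- The `n`-th Legendre polynomial, via the Rodrigues formula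
`P_n = (1/(2^n n!)) dⁿ/dxⁿ (x² - 1)ⁿ` (so that `P_n(1) = 1`). -/
def legendreP (n : ℕ) : Polynomial ℝ :=
  Polynomial.C (1 / ((2 : ℝ) ^ n * n.factorial)) *
    (⇑Polynomial.derivative)^[n] ((Polynomial.X ^ 2 - 1) ^ n)

/-- The `L²(S²)`-orthogonal projection onto the spherical harmonics of degree `m`:
`(Q_m g)(x) = ((2m+1)/(4π)) ∫_{S²} P_m(⟨x,y⟩) g(y) dσ(y)`. -/
def sphHarmProj (m : ℕ) (g : EuclideanSpace ℝ (Fin 3) → ℝ)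
    (x : EuclideanSpace ℝ (Fin 3)) : ℝ :=
  ((2 * (m : ℝ) + 1) / (4 * π)) *
    ∫ y : Metric.sphere (0 : EuclideanSpace ℝ (Fin 3)) 1,
      (legendreP m).eval ((inner ℝ x (y : EuclideanSpace ℝ (Fin 3)) : ℝ)) * g y
      ∂(volume : Measure (EuclideanSpace ℝ (Fin 3))).toSphere

/-- The satellite gradiometry forward operator with measurement radius `R`:
`(T f)(x) = Σ_{m=0}^∞ ((m+1)(m+2)/R^{m+3}) (Q_m f)(x)`. -/
def gradOp (R : ℝ) (f : EuclideanSpace ℝ (Fin 3) → ℝ)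
    (x : EuclideanSpace ℝ (Fin 3)) : ℝ :=
  ∑' m : ℕ, (((m : ℝ) + 1) * ((m : ℝ) + 2) / R ^ (m + 3)) * sphHarmProj m f x

end

section SphereMoments

open Set Metric

/-- The `k`-th moment of the one-dimensional Gaussian weight `exp (-t ^ 2)`. -/
noncomputable def gaussMoment (k : ℕ) : ℝ := ∫ t : ℝ, t ^ k * Real.exp (-t ^ 2)

/-- The `k`-th moment of the weight `exp (-t ^ 2)` on the positive half-line. -/
noncomputable def gaussHalfMoment (k : ℕ) : ℝ := ∫ t in Ioi (0 : ℝ), t ^ k * Real.exp (-t ^ 2)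

lemma gaussHalfMoment_eq (k : ℕ) : gaussHalfMoment k = Real.Gamma ((k + 1) / 2) / 2 := by
  have h := integral_rpow_mul_exp_neg_rpow (p := 2) (q := k) two_pos
    (by have : (0 : ℝ) ≤ k := k.cast_nonneg
        linarith)
  simp only [Real.rpow_natCast, Real.rpow_two] at h
  rw [gaussHalfMoment, h]
  ring

lemma gaussHalfMoment_pos (k : ℕ) : 0 < gaussHalfMoment k := by
  rw [gaussHalfMoment_eq]
  have := Real.Gamma_pos_of_pos (s := ((k : ℝ) + 1) / 2) (by positivity)
  positivity

lemma gaussHalfMoment_add_two (k : ℕ) :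
    gaussHalfMoment (k + 2) = (k + 1) / 2 * gaussHalfMoment k := by
  rw [gaussHalfMoment_eq, gaussHalfMoment_eq]
  have : (((k + 2 : ℕ) : ℝ) + 1) / 2 = ((k : ℝ) + 1) / 2 + 1 := by push_cast; ring
  rw [this, Real.Gamma_add_one (by positivity)]
  ring

lemma gaussMoment_even {k : ℕ} (hk : Even k) : gaussMoment k = 2 * gaussHalfMoment k := by
  have h := integral_comp_abs (f := fun t : ℝ => t ^ k * Real.exp (-t ^ 2))
  simp only [hk.pow_abs, sq_abs] at h
  exact h

lemma gaussMoment_odd {k : ℕ} (hk : Odd k) : gaussMoment k = 0 := by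
  have h := integral_neg_eq_self (fun t : ℝ => t ^ k * Real.exp (-t ^ 2)) volume
  simp only [hk.neg_pow, neg_sq, neg_mul, integral_neg] at h
  unfold gaussMoment
  linarith

lemma gaussMoment_zero_sq : gaussMoment 0 ^ 2 = π := by
  have h := integral_gaussian 1
  simp only [neg_mul, one_mul, div_one] at h
  simp only [gaussMoment, pow_zero, one_mul]
  rw [h, Real.sq_sqrt Real.pi_pos.le]

local notation "E3" => EuclideanSpace ℝ (Fin 3)
local notation "σ₂" => Measure.toSphere (volume : Measure (EuclideanSpace ℝ (Fin 3)))

/-- Integration of a homogeneous function against the Gaussian weight in polar coordinates. -/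
lemma integral_homogeneous_mul_exp (p : E3 → ℝ) (d : ℕ)
    (hp : ∀ (r : ℝ) (y : E3), p (r • y) = r ^ d * p y) :
    ∫ y, p y * Real.exp (-‖y‖ ^ 2) =
      (∫ y : sphere (0 : E3) 1, p y ∂σ₂) * gaussHalfMoment (d + 2) := by
  have hvol : ∫ y, p y * Real.exp (-‖y‖ ^ 2) =
      ∫ y : ({(0)}ᶜ : Set E3), p y * Real.exp (-‖(y : E3)‖ ^ 2)
        ∂((volume : Measure E3).comap (↑)) := by
    rw [integral_subtype_comap (measurableSet_singleton _).compl
      fun y : E3 => p y * Real.exp (-‖y‖ ^ 2), restrict_compl_singleton]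
  have hprod := (volume : Measure E3).measurePreserving_homeomorphUnitSphereProd.integral_comp
    (Homeomorph.measurableEmbedding _)
    (fun z => p z.1 * ((z.2 : ℝ) ^ d * Real.exp (-(z.2 : ℝ) ^ 2)))
  rw [integral_prod_mul (fun y : sphere (0 : E3) 1 => p y)
    (fun r : Ioi (0 : ℝ) => (r : ℝ) ^ d * Real.exp (-(r : ℝ) ^ 2))] at hprod
  have hrad : ∫ r : Ioi (0 : ℝ), (r : ℝ) ^ d * Real.exp (-(r : ℝ) ^ 2)
      ∂Measure.volumeIoiPow (Module.finrank ℝ E3 - 1) = gaussHalfMoment (d + 2) := by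
    simp only [Measure.volumeIoiPow, ENNReal.ofReal]
    rw [integral_withDensity_eq_integral_smul
        (measurable_subtype_coe.pow_const _).real_toNNReal,
      integral_subtype_comap measurableSet_Ioi fun a : ℝ =>
        Real.toNNReal (a ^ (Module.finrank ℝ E3 - 1)) • (a ^ d * Real.exp (-a ^ 2)),
      gaussHalfMoment]
    refine setIntegral_congr_fun measurableSet_Ioi fun x hx => ?_
    simp only [NNReal.smul_def, Real.coe_toNNReal _ (pow_nonneg (le_of_lt hx) _),
      finrank_euclideanSpace_fin, smul_eq_mul]
    ring
  rw [hrad] at hprod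
  rw [hvol, ← hprod]
  refine integral_congr_ae (.of_forall fun y => ?_)
  have hy : (0 : ℝ) < ‖(y : E3)‖ := norm_pos_iff.2 y.2
  simp only [homeomorphUnitSphereProd_apply_fst_coe, homeomorphUnitSphereProd_apply_snd_coe, hp,
    inv_pow]
  field_simp

lemma integral_sphere_prod_inner_pow (b : OrthonormalBasis (Fin 3) ℝ E3) (e : Fin 3 → ℕ) :
    (∫ y : sphere (0 : E3) 1, ∏ i, inner ℝ (b i) (y : E3) ^ e i ∂σ₂) *
      gaussHalfMoment ((∑ i, e i) + 2) = ∏ i, gaussMoment (e i) := by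
  rw [← integral_homogeneous_mul_exp (fun y => ∏ i, inner ℝ (b i) y ^ e i)]
  · have h1 := b.measurePreserving_repr.integral_comp
      b.repr.toHomeomorph.measurableEmbedding
      (fun v : E3 => ∏ i, (v i ^ e i * Real.exp (-v i ^ 2)))
    have h2 := (PiLp.volume_preserving_ofLp (Fin 3)).integral_comp
      (MeasurableEquiv.toLp 2 (Fin 3 → ℝ)).symm.measurableEmbedding
      (fun v : Fin 3 → ℝ => ∏ i, (v i ^ e i * Real.exp (-v i ^ 2)))
    rw [integral_fintype_prod_volume_eq_prod
      (f := fun i (t : ℝ) => t ^ e i * Real.exp (-t ^ 2))] at h2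
    unfold gaussMoment
    rw [← h2, ← h1]
    refine integral_congr_ae (.of_forall fun y => ?_)
    simp only [b.repr_apply_apply, Finset.prod_mul_distrib, ← Real.exp_sum, Finset.sum_neg_distrib]
    rw [← b.sum_sq_norm_inner_right y]
    simp
  · intro r y
    simp only [inner_smul_right, mul_pow, Finset.prod_mul_distrib, Finset.prod_pow_eq_pow_sum]

lemma integral_sphere_inner_pow (b : OrthonormalBasis (Fin 3) ℝ E3) (j l k : ℕ) :
    (∫ y : sphere (0 : E3) 1, inner ℝ (b 1) (y : E3) ^ j * inner ℝ (b 2) (y : E3) ^ l *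
      inner ℝ (b 0) (y : E3) ^ k ∂σ₂) * gaussHalfMoment (j + l + k + 2) =
      gaussMoment j * gaussMoment l * gaussMoment k := by
  have h := integral_sphere_prod_inner_pow b ![k, j, l]
  simp only [Fin.prod_univ_three, Fin.sum_univ_three, Matrix.cons_val] at h
  rw [show j + l + k + 2 = k + j + l + 2 by ring,
    show gaussMoment j * gaussMoment l * gaussMoment k =
      gaussMoment k * gaussMoment j * gaussMoment l by ring, ← h]
  congr 2
  ext y
  ring

end SphereMoments

section Legendre

open Polynomial

lemma integral_derivative_mul (f q : ℝ[X]) :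
    ∫ t in (-1 : ℝ)..1, (derivative f).eval t * q.eval t =
      f.eval 1 * q.eval 1 - f.eval (-1) * q.eval (-1) -
        ∫ t in (-1 : ℝ)..1, f.eval t * (derivative q).eval t := by
  have h := intervalIntegral.integral_mul_deriv_eq_deriv_mul (a := -1) (b := 1)
    (fun t _ => q.hasDerivAt t) (fun t _ => f.hasDerivAt t)
    ((derivative q).continuous.intervalIntegrable _ _)
    ((derivative f).continuous.intervalIntegrable _ _)
  simpa only [mul_comm] using h

lemma sq_sub_one_pow_eq (n : ℕ) (r : ℝ) (hr : r ^ 2 = 1) :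
    ((X ^ 2 - 1 : ℝ[X]) ^ n).map (algebraMap ℝ ℝ) = (X - C r) ^ n * (X + C r) ^ n := by
  have : (C r * C r : ℝ[X]) = 1 := by rw [← C_mul, ← sq, hr, C_1]
  rw [Algebra.algebraMap_self, Polynomial.map_id, ← mul_pow]
  congr 1
  linear_combination this

lemma eval_iterate_derivative_sq_sub_one_pow {n k : ℕ} (hk : k < n) (r : ℝ) (hr : r ^ 2 = 1) :
    (derivative^[k] ((X ^ 2 - 1 : ℝ[X]) ^ n)).eval r = 0 := by
  simpa using aeval_iterate_derivative_of_lt ((X ^ 2 - 1 : ℝ[X]) ^ n) n r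
    (sq_sub_one_pow_eq n r hr) hk

lemma integral_iterate_derivative_sq_sub_one_pow_mul {n k : ℕ} (hk : k ≤ n) (q : ℝ[X]) :
    ∫ t in (-1 : ℝ)..1, (derivative^[k] ((X ^ 2 - 1 : ℝ[X]) ^ n)).eval t * q.eval t =
      (-1) ^ k * ∫ t in (-1 : ℝ)..1,
        ((X ^ 2 - 1 : ℝ[X]) ^ n).eval t * (derivative^[k] q).eval t := by
  induction k generalizing q with
  | zero => simp
  | succ k ih =>
    rw [Function.iterate_succ_apply', integral_derivative_mul,
      eval_iterate_derivative_sq_sub_one_pow hk 1 (by norm_num),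
      eval_iterate_derivative_sq_sub_one_pow hk (-1) (by norm_num), ih (by omega),
      ← Function.iterate_succ_apply]
    ring

lemma integral_legendreP_mul_of_degree_lt (n : ℕ) (q : ℝ[X]) (hq : q.degree < n) :
    ∫ t in (-1 : ℝ)..1, (legendreP n).eval t * q.eval t = 0 := by
  have hD : derivative^[n] q = 0 := by
    rcases eq_or_ne q 0 with rfl | h0
    · simp
    · exact iterate_derivative_eq_zero ((natDegree_lt_iff_degree_lt h0).2 hq)
  simp only [legendreP, eval_mul, eval_C, mul_assoc]
  rw [intervalIntegral.integral_const_mul, integral_iterate_derivative_sq_sub_one_pow_mul le_rfl,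
    hD]
  simp

lemma legendreP_eval_one (n : ℕ) : (legendreP n).eval 1 = 1 := by
  have h := aeval_iterate_derivative_self ((X ^ 2 - 1 : ℝ[X]) ^ n) n (1 : ℝ)
    (sq_sub_one_pow_eq n 1 (by norm_num))
  have hf : (n.factorial : ℝ) ≠ 0 := by positivity
  simp only [coe_aeval_eq_eval, eval_pow, eval_add, eval_X, eval_C, nsmul_eq_mul] at h
  rw [legendreP, eval_mul, eval_C, h]
  norm_num
  field_simp

lemma legendreP_degree (n : ℕ) : (legendreP n).degree = n := by
  have hm : ((X ^ 2 - 1 : ℝ[X]) ^ n).Monic := (monic_X_pow_sub_C (1 : ℝ) two_ne_zero).pow n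
  have hd : ((X ^ 2 - 1 : ℝ[X]) ^ n).natDegree = n + n := by
    have : (X ^ 2 - 1 : ℝ[X]).natDegree = 2 := natDegree_X_pow_sub_C (r := (1 : ℝ))
    rw [natDegree_pow, this]
    ring
  have hc : (1 / ((2 : ℝ) ^ n * n.factorial)) ≠ 0 := by positivity
  rw [legendreP, degree_C_mul hc]
  refine le_antisymm (degree_le_of_natDegree_le ?_) (le_degree_of_ne_zero ?_)
  · refine (natDegree_iterate_derivative _ _).trans ?_
    omega
  · rw [coeff_iterate_derivative, ← hd, hm.coeff_natDegree]
    simp only [nsmul_eq_mul, mul_one, ne_eq, Nat.cast_eq_zero, Nat.descFactorial_eq_zero_iff_lt]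
    omega

lemma integral_legendreP_sq (n : ℕ) :
    ∫ t in (-1 : ℝ)..1, (legendreP n).eval t * (legendreP n).eval t = 2 / (2 * n + 1) := by
  set P := legendreP n with hP
  have hparts := integral_derivative_mul P ((X + 1) * P)
  have hdeg : ((X + 1) * derivative P - C (n : ℝ) * P).degree < (n : WithBot ℕ) := by
    have hle : ((X + 1) * derivative P - C (n : ℝ) * P).degree ≤ (n : WithBot ℕ) := by
      rw [degree_le_iff_coeff_zero]
      intro m hm
      have hm' : n < m := by exact_mod_cast hm
      have h0 : ∀ k, n < k → P.coeff k = 0 := fun k hk =>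
        coeff_eq_zero_of_degree_lt (by rw [hP, legendreP_degree]; exact_mod_cast hk)
      obtain ⟨m, rfl⟩ : ∃ k, m = k + 1 := ⟨m - 1, by omega⟩
      simp [add_mul, coeff_X_mul, coeff_derivative, h0 (m + 1) hm', h0 (m + 1 + 1) (by omega)]
    refine lt_of_le_of_ne hle fun h => ?_
    have hne : ((X + 1) * derivative P - C (n : ℝ) * P).coeff n ≠ 0 := coeff_ne_zero_of_eq_degree h
    apply hne
    have h1 : P.coeff (n + 1) = 0 :=
      coeff_eq_zero_of_degree_lt (by rw [hP, legendreP_degree]; exact_mod_cast n.lt_succ_self)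
    cases n with
    | zero => simp [add_mul, coeff_derivative, mul_coeff_zero, h1]
    | succ k =>
      simp only [add_mul, one_mul, coeff_sub, coeff_add, coeff_X_mul, coeff_derivative,
        coeff_C_mul, h1]
      push_cast
      ring
  have horth := integral_legendreP_mul_of_degree_lt n _ hdeg
  rw [← hP] at horth
  have hcont : ∀ p q : ℝ[X],
      IntervalIntegrable (fun t => p.eval t * q.eval t) volume (-1) 1 := fun p q =>
    (p.continuous.mul q.continuous).intervalIntegrable _ _
  have e1 : ∫ t in (-1 : ℝ)..1, P.eval t * ((X + 1) * derivative P - C (n : ℝ) * P).eval t =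
      (∫ t in (-1 : ℝ)..1, (derivative P).eval t * ((X + 1) * P).eval t) -
        n * ∫ t in (-1 : ℝ)..1, P.eval t * P.eval t := by
    rw [← intervalIntegral.integral_const_mul, ← intervalIntegral.integral_sub (hcont _ _)
      ((hcont _ _).const_mul _)]
    congr 1
    ext t
    simp
    ring
  have e2 : ∫ t in (-1 : ℝ)..1, P.eval t * (derivative ((X + 1) * P)).eval t =
      (∫ t in (-1 : ℝ)..1, (derivative P).eval t * ((X + 1) * P).eval t) +
        ∫ t in (-1 : ℝ)..1, P.eval t * P.eval t := by
    rw [← intervalIntegral.integral_add (hcont _ _) (hcont _ _)]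
    congr 1
    ext t
    simp
    ring
  rw [e2] at hparts
  rw [e1] at horth
  have h1 : P.eval 1 = 1 := legendreP_eval_one n
  simp only [eval_mul, eval_add, eval_X, eval_one, h1] at hparts horth
  rw [eq_div_iff (by positivity)]
  norm_num at hparts
  linarith

end Legendre

section ZonalIntegrals

open Set Metric Polynomial

local notation "E3" => EuclideanSpace ℝ (Fin 3)
local notation "σ₂" => Measure.toSphere (volume : Measure (EuclideanSpace ℝ (Fin 3)))

lemma integrable_sphere_of_continuous {f : sphere (0 : E3) 1 → ℝ} (hf : Continuous f) :
    Integrable f σ₂ :=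
  hf.integrable_of_hasCompactSupport (HasCompactSupport.of_compactSpace f)

lemma continuous_eval_inner (p : ℝ[X]) (x : E3) :
    Continuous fun y : sphere (0 : E3) 1 => p.eval (inner ℝ x (y : E3)) :=
  p.continuous.comp (continuous_const.inner continuous_subtype_val)

lemma integrable_eval_inner_mul_eval_inner (p q : ℝ[X]) (x z : E3) :
    Integrable (fun y : sphere (0 : E3) 1 =>
      p.eval (inner ℝ x (y : E3)) * q.eval (inner ℝ z (y : E3))) σ₂ :=
  integrable_sphere_of_continuous ((continuous_eval_inner p x).mul (continuous_eval_inner q z))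

lemma exists_orthonormalBasis_adapted (z x : E3) (hz : ‖z‖ = 1) :
    ∃ b : OrthonormalBasis (Fin 3) ℝ E3, b 0 = z ∧
      ∃ s : ℝ, x = (inner ℝ z x : ℝ) • z + s • b 1 := by
  have hcard : Module.finrank ℝ E3 = Fintype.card (Fin 3) := by simp
  let f : Fin 3 → E3 := ![z, x, 0]
  let b := InnerProductSpace.gramSchmidtOrthonormalBasis hcard f
  have hf0 : InnerProductSpace.gramSchmidtNormed ℝ f 0 = z := by
    have h0 : InnerProductSpace.gramSchmidt ℝ f 0 = z :=
      InnerProductSpace.gramSchmidt_bot ℝ f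
    rw [InnerProductSpace.gramSchmidtNormed, h0, hz]
    simp
  have hb0 : b 0 = z := by
    have hne : InnerProductSpace.gramSchmidtNormed ℝ f 0 ≠ 0 := by
      rw [hf0]
      exact fun h => by simp [h] at hz
    exact (InnerProductSpace.gramSchmidtOrthonormalBasis_apply hcard hne).trans hf0
  have hb2 : inner ℝ (b 2) x = 0 :=
    InnerProductSpace.gramSchmidtOrthonormalBasis_inv_triangular hcard f
      (show (1 : Fin 3) < 2 by decide)
  refine ⟨b, hb0, inner ℝ (b 1) x, ?_⟩
  have h := b.sum_repr' x
  rw [Fin.sum_univ_three, hb2, zero_smul, add_zero, hb0] at h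
  exact h.symm

/-- Archimedean hat-box theorem for polynomials: the zonal marginal of the surface measure is uniform. -/
lemma integral_sphere_zonal (z : E3) (hz : ‖z‖ = 1) (p : ℝ[X]) :
    ∫ y : sphere (0 : E3) 1, p.eval (inner ℝ z (y : E3)) ∂σ₂ =
      2 * π * ∫ t in (-1 : ℝ)..1, p.eval t := by
  induction p using Polynomial.induction_on' with
  | add p q hp hq =>
    simp only [eval_add]
    rw [integral_add (integrable_sphere_of_continuous (continuous_eval_inner p z))
      (integrable_sphere_of_continuous (continuous_eval_inner q z)), hp, hq,
      intervalIntegral.integral_add (p.continuous.intervalIntegrable _ _)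
      (q.continuous.intervalIntegrable _ _)]
    ring
  | monomial k a =>
    simp only [eval_monomial, integral_const_mul, intervalIntegral.integral_const_mul,
      integral_pow]
    obtain ⟨b, rfl, -⟩ := exists_orthonormalBasis_adapted z z hz
    have h := integral_sphere_inner_pow b 0 0 k
    simp only [pow_zero, one_mul, zero_add, gaussHalfMoment_add_two] at h
    rw [← sq, gaussMoment_zero_sq] at h
    have hpos := gaussHalfMoment_pos k
    have hk : (0 : ℝ) < k + 1 := by positivity
    set I := ∫ y : sphere (0 : E3) 1, inner ℝ (b 0) (y : E3) ^ k ∂σ₂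
    rcases k.even_or_odd with he | ho
    · rw [gaussMoment_even he] at h
      have hI : I * (k + 1) = 4 * π := by
        refine mul_right_cancel₀ hpos.ne' ?_
        linarith
      rw [(he.add_one).neg_one_pow, one_pow]
      field_simp
      linear_combination a * hI
    · rw [gaussMoment_odd ho, mul_zero] at h
      have hI : I = 0 := by
        rcases mul_eq_zero.1 h with h | h
        · exact h
        · exact absurd h (by positivity)
      rw [(ho.add_one).neg_one_pow, hI]
      simp

lemma integral_sphere_transverse_pow_mul_pow (b : OrthonormalBasis (Fin 3) ℝ E3) (i k : ℕ) :
    (∫ y : sphere (0 : E3) 1, (1 - inner ℝ (b 0) (y : E3) ^ 2) ^ i *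
        inner ℝ (b 0) (y : E3) ^ k ∂σ₂) * gaussHalfMoment (2 * i + k + 2) =
      (∑ l ∈ Finset.range (i + 1),
        gaussMoment (2 * l) * gaussMoment (2 * (i - l)) * (i.choose l)) * gaussMoment k := by
  have hsq : ∀ y : sphere (0 : E3) 1, 1 - inner ℝ (b 0) (y : E3) ^ 2 =
      inner ℝ (b 1) (y : E3) ^ 2 + inner ℝ (b 2) (y : E3) ^ 2 := fun y => by
    have h := b.sum_sq_norm_inner_right (y : E3)
    rw [Fin.sum_univ_three, norm_eq_of_mem_sphere] at h
    simp only [Real.norm_eq_abs, sq_abs] at h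
    linarith
  have hint : ∀ l : ℕ, Integrable (fun y : sphere (0 : E3) 1 =>
      (inner ℝ (b 1) (y : E3) ^ (2 * l) * inner ℝ (b 2) (y : E3) ^ (2 * (i - l)) *
        inner ℝ (b 0) (y : E3) ^ k) * (i.choose l : ℝ)) σ₂ := fun l =>
    integrable_sphere_of_continuous (by fun_prop)
  have hexp : ∀ y : sphere (0 : E3) 1, (1 - inner ℝ (b 0) (y : E3) ^ 2) ^ i *
      inner ℝ (b 0) (y : E3) ^ k = ∑ l ∈ Finset.range (i + 1),
      (inner ℝ (b 1) (y : E3) ^ (2 * l) * inner ℝ (b 2) (y : E3) ^ (2 * (i - l)) *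
        inner ℝ (b 0) (y : E3) ^ k) * (i.choose l : ℝ) := fun y => by
    rw [hsq, add_pow, Finset.sum_mul]
    refine Finset.sum_congr rfl fun l _ => ?_
    rw [pow_mul, pow_mul]
    ring
  simp only [hexp]
  rw [integral_finsetSum _ fun l _ => hint l, Finset.sum_mul, Finset.sum_mul]
  refine Finset.sum_congr rfl fun l hl => ?_
  have hl' : l ≤ i := Nat.lt_succ_iff.1 (Finset.mem_range.1 hl)
  have h := integral_sphere_inner_pow b (2 * l) (2 * (i - l)) k
  rw [show 2 * l + 2 * (i - l) + k + 2 = 2 * i + k + 2 by omega] at h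
  rw [integral_mul_const, mul_right_comm, h]
  ring

/-- Averaging a power of a transverse coordinate over the parallels around the pole `b 0`. -/
lemma exists_zonal_average_transverse_pow (b : OrthonormalBasis (Fin 3) ℝ E3) (j : ℕ) :
    ∃ g : ℝ[X], g.natDegree ≤ j ∧ g.eval 1 = 0 ^ j ∧ ∀ k : ℕ,
      ∫ y : sphere (0 : E3) 1, inner ℝ (b 1) (y : E3) ^ j * inner ℝ (b 0) (y : E3) ^ k ∂σ₂ =
        ∫ y : sphere (0 : E3) 1, g.eval (inner ℝ (b 0) (y : E3)) *
          inner ℝ (b 0) (y : E3) ^ k ∂σ₂ := by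
  rcases j.even_or_odd' with ⟨i, rfl | rfl⟩
  · rcases i.eq_zero_or_pos with rfl | hi
    · exact ⟨1, by simp, by simp, fun k => by simp⟩
    set B := ∑ l ∈ Finset.range (i + 1),
      gaussMoment (2 * l) * gaussMoment (2 * (i - l)) * (i.choose l : ℝ) with hB
    have hBpos : 0 < B := by
      refine Finset.sum_pos (fun l hl => ?_) (by simp)
      have h1 := gaussHalfMoment_pos (2 * l)
      have h2 := gaussHalfMoment_pos (2 * (i - l))
      have h3 : 0 < i.choose l := Nat.choose_pos (Nat.lt_succ_iff.1 (Finset.mem_range.1 hl))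
      rw [gaussMoment_even (even_two_mul _), gaussMoment_even (even_two_mul _)]
      positivity
    refine ⟨C (gaussMoment (2 * i) * gaussMoment 0 / B) * (1 - X ^ 2) ^ i, ?_, ?_, fun k => ?_⟩
    · refine (natDegree_C_mul_le _ _).trans (natDegree_pow_le.trans ?_)
      rw [mul_comm 2 i]
      gcongr
      compute_degree
    · simp [hi.ne']
    · have h1 := integral_sphere_inner_pow b (2 * i) 0 k
      have h2 := integral_sphere_transverse_pow_mul_pow b i k
      rw [← hB] at h2
      simp only [pow_zero, mul_one, add_zero] at h1
      simp only [eval_mul, eval_C, eval_pow, eval_sub, eval_one, eval_X, mul_assoc]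
      rw [integral_const_mul]
      refine mul_right_cancel₀ (gaussHalfMoment_pos (2 * i + k + 2)).ne' ?_
      have h3 : ∀ u : ℝ, u * (∫ y : sphere (0 : E3) 1, (1 - inner ℝ (b 0) (y : E3) ^ 2) ^ i *
          inner ℝ (b 0) (y : E3) ^ k ∂σ₂) * gaussHalfMoment (2 * i + k + 2) =
          u * (B * gaussMoment k) := fun u => by rw [mul_assoc, h2]
      rw [h1, h3]
      field_simp
  · refine ⟨0, by simp, by simp, fun k => ?_⟩
    have h := integral_sphere_inner_pow b (2 * i + 1) 0 k
    rw [gaussMoment_odd (k := 2 * i + 1) ⟨i, rfl⟩] at h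
    simp only [pow_zero, mul_one, zero_mul, mul_eq_zero,
      (gaussHalfMoment_pos _).ne', or_false] at h
    simpa using h

lemma exists_zonal_average_pow_mul_pow (b : OrthonormalBasis (Fin 3) ℝ E3) (c s : ℝ) (a j : ℕ) :
    ∃ g : ℝ[X], g.natDegree ≤ a + j ∧ g.eval 1 = c ^ a * 0 ^ j ∧ ∀ k : ℕ,
      ∫ y : sphere (0 : E3) 1, inner ℝ (c • b 0 + s • b 1) (y : E3) ^ a *
          inner ℝ (b 1) (y : E3) ^ j * inner ℝ (b 0) (y : E3) ^ k ∂σ₂ =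
        ∫ y : sphere (0 : E3) 1, g.eval (inner ℝ (b 0) (y : E3)) *
          inner ℝ (b 0) (y : E3) ^ k ∂σ₂ := by
  induction a generalizing j with
  | zero => simpa using exists_zonal_average_transverse_pow b j
  | succ a ih =>
    obtain ⟨g₁, hd₁, he₁, hI₁⟩ := ih j
    obtain ⟨g₂, hd₂, he₂, hI₂⟩ := ih (j + 1)
    refine ⟨C c * X * g₁ + C s * g₂, ?_, ?_, fun k => ?_⟩
    · refine natDegree_add_le_of_degree_le ?_ ?_
      · refine natDegree_mul_le.trans ?_
        have : (C c * X : ℝ[X]).natDegree ≤ 1 := by compute_degree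
        omega
      · refine (natDegree_C_mul_le _ _).trans ?_
        omega
    · simp [he₁, he₂]
      ring
    · have hL : ∀ y : sphere (0 : E3) 1, inner ℝ (c • b 0 + s • b 1) (y : E3) ^ (a + 1) *
          inner ℝ (b 1) (y : E3) ^ j * inner ℝ (b 0) (y : E3) ^ k =
          c * (inner ℝ (c • b 0 + s • b 1) (y : E3) ^ a *
            inner ℝ (b 1) (y : E3) ^ j * inner ℝ (b 0) (y : E3) ^ (k + 1)) +
          s * (inner ℝ (c • b 0 + s • b 1) (y : E3) ^ a *
            inner ℝ (b 1) (y : E3) ^ (j + 1) * inner ℝ (b 0) (y : E3) ^ k) := fun y => by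
        have : inner ℝ (c • b 0 + s • b 1) (y : E3) =
            c * inner ℝ (b 0) (y : E3) + s * inner ℝ (b 1) (y : E3) := by
          simp [inner_add_left, inner_smul_left]
        rw [pow_succ]
        nth_rewrite 2 [this]
        ring
      have hR : ∀ y : sphere (0 : E3) 1, (C c * X * g₁ + C s * g₂).eval (inner ℝ (b 0) (y : E3)) *
          inner ℝ (b 0) (y : E3) ^ k =
          c * (g₁.eval (inner ℝ (b 0) (y : E3)) * inner ℝ (b 0) (y : E3) ^ (k + 1)) +
          s * (g₂.eval (inner ℝ (b 0) (y : E3)) * inner ℝ (b 0) (y : E3) ^ k) := fun y => by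
        simp
        ring
      have hc₁ := continuous_eval_inner g₁ (b 0)
      have hc₂ := continuous_eval_inner g₂ (b 0)
      simp only [hL, hR]
      rw [integral_add (integrable_sphere_of_continuous (by fun_prop))
          (integrable_sphere_of_continuous (by fun_prop)),
        integral_add (integrable_sphere_of_continuous (by fun_prop))
          (integrable_sphere_of_continuous (by fun_prop)),
        integral_const_mul, integral_const_mul, integral_const_mul, integral_const_mul,
        hI₁, hI₂]

/-- Averaging `y ↦ p ⟪x, y⟫` over the parallels around the pole `z` gives a polynomial in
`⟪z, y⟫` of no larger degree, whose value at the pole is `p ⟪z, x⟫`. -/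
lemma exists_zonal_average (x z : E3) (hz : ‖z‖ = 1) (p : ℝ[X]) (n : ℕ) (hp : p.natDegree ≤ n) :
    ∃ h : ℝ[X], h.natDegree ≤ n ∧ h.eval 1 = p.eval (inner ℝ z x) ∧ ∀ q : ℝ[X],
      ∫ y : sphere (0 : E3) 1, p.eval (inner ℝ x (y : E3)) * q.eval (inner ℝ z (y : E3)) ∂σ₂ =
        ∫ y : sphere (0 : E3) 1,
          h.eval (inner ℝ z (y : E3)) * q.eval (inner ℝ z (y : E3)) ∂σ₂ := by
  obtain ⟨b, hb, s, hx⟩ := exists_orthonormalBasis_adapted z x hz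
  set c : ℝ := inner ℝ z x
  choose g hgd hge hgI using fun a => exists_zonal_average_pow_mul_pow b c s a 0
  refine ⟨∑ a ∈ Finset.range (n + 1), C (p.coeff a) * g a, ?_, ?_, fun q => ?_⟩
  · refine natDegree_sum_le_of_forall_le _ _ fun a ha => ?_
    refine (natDegree_C_mul_le _ _).trans ((hgd a).trans ?_)
    have := Finset.mem_range.1 ha
    omega
  · rw [eval_finsetSum, eval_eq_sum_range' (Nat.lt_succ_of_le hp)]
    simp [hge]
  · have hcx := continuous_eval_inner p x
    induction q using Polynomial.induction_on' with
    | add q₁ q₂ h₁ h₂ =>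
      have hc₁ := continuous_eval_inner q₁ z
      have hc₂ := continuous_eval_inner q₂ z
      simp only [eval_add, mul_add]
      rw [integral_add (integrable_sphere_of_continuous (by fun_prop))
          (integrable_sphere_of_continuous (by fun_prop)),
        integral_add (integrable_sphere_of_continuous (by fun_prop))
          (integrable_sphere_of_continuous (by fun_prop)), h₁, h₂]
    | monomial k r =>
      have hcg : ∀ a, Continuous fun y : sphere (0 : E3) 1 => (g a).eval (inner ℝ z (y : E3)) :=
        fun a => continuous_eval_inner (g a) z
      have hL : ∀ y : sphere (0 : E3) 1, p.eval (inner ℝ x (y : E3)) *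
          (monomial k r).eval (inner ℝ z (y : E3)) = ∑ a ∈ Finset.range (n + 1),
            (p.coeff a * r) * (inner ℝ x (y : E3) ^ a * inner ℝ z (y : E3) ^ k) := fun y => by
        rw [eval_eq_sum_range' (Nat.lt_succ_of_le hp), eval_monomial, Finset.sum_mul]
        exact Finset.sum_congr rfl fun a _ => by ring
      have hR : ∀ y : sphere (0 : E3) 1,
          (∑ a ∈ Finset.range (n + 1), C (p.coeff a) * g a).eval (inner ℝ z (y : E3)) *
          (monomial k r).eval (inner ℝ z (y : E3)) = ∑ a ∈ Finset.range (n + 1),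
            (p.coeff a * r) * ((g a).eval (inner ℝ z (y : E3)) * inner ℝ z (y : E3) ^ k) :=
        fun y => by
          rw [eval_finsetSum, eval_monomial, Finset.sum_mul]
          exact Finset.sum_congr rfl fun a _ => by simp; ring
      simp only [hL, hR]
      rw [integral_finsetSum _ fun a _ => integrable_sphere_of_continuous (by fun_prop),
        integral_finsetSum _ fun a _ => integrable_sphere_of_continuous (f := fun y =>
            (p.coeff a * r) * ((g a).eval (inner ℝ z (y : E3)) * inner ℝ z (y : E3) ^ k))
          (continuous_const.mul ((hcg a).mul (by fun_prop)))]
      refine Finset.sum_congr rfl fun a _ => ?_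
      have h := hgI a k
      simp only [pow_zero, mul_one, hb, ← hx] at h
      rw [integral_const_mul, integral_const_mul, h]

lemma integral_sphere_zonal_mul (z : E3) (hz : ‖z‖ = 1) (p q : ℝ[X]) :
    ∫ y : sphere (0 : E3) 1, p.eval (inner ℝ z (y : E3)) * q.eval (inner ℝ z (y : E3)) ∂σ₂ =
      2 * π * ∫ t in (-1 : ℝ)..1, p.eval t * q.eval t := by
  simpa using integral_sphere_zonal z hz (p * q)

lemma integral_sphere_legendreP_mul_of_degree_lt (x z : E3) (hx : ‖x‖ = 1)
    (n : ℕ) (q : ℝ[X]) (hq : q.degree < n) :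
    ∫ y : sphere (0 : E3) 1, (legendreP n).eval (inner ℝ x (y : E3)) *
      q.eval (inner ℝ z (y : E3)) ∂σ₂ = 0 := by
  rcases n.eq_zero_or_pos with rfl | hn
  · have : q = 0 := by
      rw [← degree_eq_bot]
      exact Nat.WithBot.lt_zero_iff.1 (by simpa using hq)
    simp [this]
  have hqn : q.natDegree ≤ n - 1 := by
    have : q.natDegree < n := by
      rcases eq_or_ne q 0 with rfl | h0
      · simpa using hn
      · exact (natDegree_lt_iff_degree_lt h0).2 hq
    omega
  obtain ⟨h, hd, -, hI⟩ := exists_zonal_average z x hx q (n - 1) hqn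
  have := hI (legendreP n)
  simp only [mul_comm (q.eval _), mul_comm (h.eval _)] at this
  rw [this, integral_sphere_zonal_mul x hx, integral_legendreP_mul_of_degree_lt n h, mul_zero]
  exact (degree_le_of_natDegree_le hd).trans_lt (by exact_mod_cast Nat.sub_lt hn one_pos)

/-- The reproducing property of the zonal harmonics. -/
theorem integral_sphere_legendreP_mul_legendreP (x z : E3) (hx : ‖x‖ = 1) (hz : ‖z‖ = 1)
    (n m : ℕ) :
    ∫ y : sphere (0 : E3) 1, (legendreP n).eval (inner ℝ x (y : E3)) *
      (legendreP m).eval (inner ℝ z (y : E3)) ∂σ₂ =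
      if n = m then 4 * π / (2 * n + 1) * (legendreP n).eval (inner ℝ x z) else 0 := by
  rcases lt_trichotomy n m with hnm | rfl | hnm
  · simp only [mul_comm ((legendreP n).eval _)]
    rw [if_neg hnm.ne, integral_sphere_legendreP_mul_of_degree_lt z x hz]
    rw [legendreP_degree]
    exact_mod_cast hnm
  · rw [if_pos rfl]
    set P := legendreP n with hP
    have hPd : P.degree = n := legendreP_degree n
    obtain ⟨h, hd, he, hI⟩ := exists_zonal_average x z hz P n (natDegree_eq_of_degree_eq_some hPd).le
    set a := h.coeff n / P.coeff n
    have hPn : P.coeff n ≠ 0 := coeff_ne_zero_of_eq_degree hPd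
    set D := h - C a * P with hD
    have hDd : D.degree < n := by
      rw [degree_lt_iff_coeff_zero]
      intro k hk
      rcases hk.eq_or_lt with rfl | hk
      · simp [hD, a, hPn]
      · have h1 : h.coeff k = 0 := coeff_eq_zero_of_natDegree_lt (hd.trans_lt hk)
        have h2 : P.coeff k = 0 := coeff_eq_zero_of_degree_lt (by rw [hPd]; exact_mod_cast hk)
        simp [hD, h1, h2]
    have hcz := fun p => continuous_eval_inner p z
    have hsplit : ∀ q : ℝ[X], ∫ y : sphere (0 : E3) 1,
        D.eval (inner ℝ z (y : E3)) * q.eval (inner ℝ z (y : E3)) ∂σ₂ =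
        (∫ y : sphere (0 : E3) 1, P.eval (inner ℝ x (y : E3)) * q.eval (inner ℝ z (y : E3)) ∂σ₂) -
        a * ∫ y : sphere (0 : E3) 1,
          P.eval (inner ℝ z (y : E3)) * q.eval (inner ℝ z (y : E3)) ∂σ₂ := fun q => by
      rw [hI q, ← integral_const_mul, ← integral_sub
        (integrable_eval_inner_mul_eval_inner _ _ _ _)
        ((integrable_eval_inner_mul_eval_inner _ _ _ _).const_mul _)]
      congr 1
      ext y
      simp [hD]
      ring
    have hDD : ∫ y : sphere (0 : E3) 1,
        D.eval (inner ℝ z (y : E3)) * D.eval (inner ℝ z (y : E3)) ∂σ₂ = 0 := by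
      rw [hsplit, integral_sphere_legendreP_mul_of_degree_lt x z hx n D hDd,
        integral_sphere_legendreP_mul_of_degree_lt z z hz n D hDd]
      ring
    have hD1 : D.eval 1 = 0 := by
      have hae := (integral_eq_zero_iff_of_nonneg (fun y => mul_self_nonneg _)
        (integrable_eval_inner_mul_eval_inner D D z z)).1 hDD
      have hfun := (((hcz D).mul (hcz D)).ae_eq_iff_eq σ₂ continuous_const).1 hae
      have hzz : D.eval (inner ℝ z z) * D.eval (inner ℝ z z) = 0 :=
        congr_fun hfun ⟨z, by simpa using hz⟩
      have hself : inner ℝ z z = (1 : ℝ) := by rw [real_inner_self_eq_norm_sq, hz, one_pow]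
      rw [hself] at hzz
      exact mul_self_eq_zero.1 hzz
    have ha : a = P.eval (inner ℝ x z) := by
      have : P.eval 1 = 1 := legendreP_eval_one n
      simp only [hD, eval_sub, eval_mul, eval_C, this, mul_one, he] at hD1
      rw [real_inner_comm]
      linarith
    have hDP := hsplit P
    have hDP0 : ∫ y : sphere (0 : E3) 1,
        D.eval (inner ℝ z (y : E3)) * P.eval (inner ℝ z (y : E3)) ∂σ₂ = 0 := by
      simp only [mul_comm (D.eval _)]
      exact integral_sphere_legendreP_mul_of_degree_lt z z hz n D hDd
    rw [hDP0, integral_sphere_zonal_mul z hz, integral_legendreP_sq] at hDP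
    rw [← ha]
    linear_combination -hDP
  · rw [if_neg hnm.ne', integral_sphere_legendreP_mul_of_degree_lt x z hx]
    rw [legendreP_degree]
    exact_mod_cast hnm

lemma abs_legendreP_inner_le_one (x z : E3) (hx : ‖x‖ = 1) (hz : ‖z‖ = 1) (n : ℕ) :
    |(legendreP n).eval (inner ℝ x z)| ≤ 1 := by
  have hpos : (0 : ℝ) < 4 * π / (2 * n + 1) := by positivity
  have hself : ∀ w : E3, ‖w‖ = 1 → ∫ y : sphere (0 : E3) 1,
      (legendreP n).eval (inner ℝ w (y : E3)) * (legendreP n).eval (inner ℝ w (y : E3)) ∂σ₂ =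
      4 * π / (2 * n + 1) := fun w hw => by
    rw [integral_sphere_legendreP_mul_legendreP w w hw hw, if_pos rfl,
      real_inner_self_eq_norm_sq, hw, one_pow, legendreP_eval_one, mul_one]
  have hxz := integral_sphere_legendreP_mul_legendreP x z hx hz n n
  rw [if_pos rfl] at hxz
  have hint := fun v w : E3 => integrable_eval_inner_mul_eval_inner (legendreP n) (legendreP n) v w
  have key : |4 * π / (2 * n + 1) * (legendreP n).eval (inner ℝ x z)| ≤ 4 * π / (2 * n + 1) := by
    rw [← hxz]
    calc _ ≤ ∫ y : sphere (0 : E3) 1, |(legendreP n).eval (inner ℝ x (y : E3)) *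
          (legendreP n).eval (inner ℝ z (y : E3))| ∂σ₂ := abs_integral_le_integral_abs
      _ ≤ ∫ y : sphere (0 : E3) 1, (2⁻¹ * ((legendreP n).eval (inner ℝ x (y : E3)) *
          (legendreP n).eval (inner ℝ x (y : E3))) + 2⁻¹ *
          ((legendreP n).eval (inner ℝ z (y : E3)) *
          (legendreP n).eval (inner ℝ z (y : E3)))) ∂σ₂ := by
        refine integral_mono (hint x z).abs (((hint x x).const_mul _).add
          ((hint z z).const_mul _)) fun y => ?_
        simp only
        rw [abs_le]
        constructor <;> nlinarith [sq_nonneg ((legendreP n).eval (inner ℝ x (y : E3)) -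
          (legendreP n).eval (inner ℝ z (y : E3))), sq_nonneg ((legendreP n).eval
          (inner ℝ x (y : E3)) + (legendreP n).eval (inner ℝ z (y : E3)))]
      _ = 4 * π / (2 * n + 1) := by
        rw [integral_add ((hint x x).const_mul _) ((hint z z).const_mul _),
          integral_const_mul, integral_const_mul, hself x hx, hself z hz]
        ring
  rw [abs_mul, abs_of_pos hpos] at key
  exact (mul_le_iff_le_one_right hpos).1 key

end ZonalIntegrals

section Gradiometry

open Set Metric

local notation "E3" => EuclideanSpace ℝ (Fin 3)
local notation "σ₂" => Measure.toSphere (volume : Measure (EuclideanSpace ℝ (Fin 3)))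

variable {f : EuclideanSpace ℝ (Fin 3) → ℝ}

lemma abs_sphHarmProj_le (hf : Integrable (fun y : sphere (0 : E3) 1 => f y) σ₂) (m : ℕ)
    {x : E3} (hx : ‖x‖ = 1) :
    |sphHarmProj m f x| ≤ (2 * m + 1) / (4 * π) * ∫ y : sphere (0 : E3) 1, |f y| ∂σ₂ := by
  have hc : (0 : ℝ) ≤ (2 * m + 1) / (4 * π) := by positivity
  rw [sphHarmProj, abs_mul, abs_of_nonneg hc]
  refine mul_le_mul_of_nonneg_left ?_ hc
  refine norm_integral_le_of_norm_le (f := fun y : sphere (0 : E3) 1 =>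
    (legendreP m).eval (inner ℝ x (y : E3)) * f y) hf.abs (.of_forall fun y => ?_)
  rw [Real.norm_eq_abs, abs_mul]
  exact mul_le_of_le_one_left (abs_nonneg _)
    (abs_legendreP_inner_le_one x y hx (norm_eq_of_mem_sphere y) m)

lemma continuous_sphHarmProj (hf : Integrable (fun y : sphere (0 : E3) 1 => f y) σ₂) (m : ℕ) :
    Continuous fun x : sphere (0 : E3) 1 => sphHarmProj m f x := by
  refine continuous_const.mul (continuous_of_dominated
    (bound := fun y : sphere (0 : E3) 1 => |f y|) (fun x => ?_) (fun x => ?_) hf.abs ?_)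
  · exact (continuous_eval_inner _ _).aestronglyMeasurable.mul hf.aestronglyMeasurable
  · refine .of_forall fun y => ?_
    rw [Real.norm_eq_abs, abs_mul]
    exact mul_le_of_le_one_left (abs_nonneg _) (abs_legendreP_inner_le_one x y
      (norm_eq_of_mem_sphere x) (norm_eq_of_mem_sphere y) m)
  · refine .of_forall fun y => ?_
    exact ((legendreP m).continuous.comp (by fun_prop)).mul continuous_const

/-- The `Q_m` are mutually orthogonal idempotents. -/
theorem sphHarmProj_sphHarmProj (hf : Integrable (fun y : sphere (0 : E3) 1 => f y) σ₂)
    (n m : ℕ) {x : E3} (hx : ‖x‖ = 1) :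
    sphHarmProj n (sphHarmProj m f) x = if n = m then sphHarmProj n f x else 0 := by
  have hker : Continuous fun p : sphere (0 : E3) 1 × sphere (0 : E3) 1 =>
      (legendreP n).eval (inner ℝ x (p.1 : E3)) *
        (legendreP m).eval (inner ℝ (p.1 : E3) (p.2 : E3)) :=
    ((legendreP n).continuous.comp (by fun_prop)).mul
      ((legendreP m).continuous.comp (by fun_prop))
  have hint : Integrable (fun p : sphere (0 : E3) 1 × sphere (0 : E3) 1 =>
      (legendreP n).eval (inner ℝ x (p.1 : E3)) *
        (legendreP m).eval (inner ℝ (p.1 : E3) (p.2 : E3)) * f p.2) (Measure.prod σ₂ σ₂) := by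
    refine (hf.comp_snd σ₂).bdd_mul (c := 1) hker.aestronglyMeasurable (.of_forall fun p => ?_)
    rw [Real.norm_eq_abs, abs_mul]
    exact mul_le_one₀ (abs_legendreP_inner_le_one _ _ hx (norm_eq_of_mem_sphere _) _)
      (abs_nonneg _) (abs_legendreP_inner_le_one _ _ (norm_eq_of_mem_sphere _)
        (norm_eq_of_mem_sphere _) _)
  have hswap := integral_integral_swap (f := fun y w : sphere (0 : E3) 1 =>
      (legendreP n).eval (inner ℝ x (y : E3)) *
        (legendreP m).eval (inner ℝ (y : E3) (w : E3)) * f w) hint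
  have hinner : ∀ w : sphere (0 : E3) 1, ∫ y : sphere (0 : E3) 1,
      (legendreP n).eval (inner ℝ x (y : E3)) *
        (legendreP m).eval (inner ℝ (y : E3) (w : E3)) * f w ∂σ₂ =
      (if n = m then 4 * π / (2 * n + 1) else 0) *
        ((legendreP n).eval (inner ℝ x (w : E3)) * f w) := fun w => by
    rw [integral_mul_const]
    simp only [real_inner_comm (w : E3)]
    rw [integral_sphere_legendreP_mul_legendreP x w hx (norm_eq_of_mem_sphere w)]
    rw [real_inner_comm x]
    split_ifs <;> ring
  simp only [hinner] at hswap
  rw [integral_const_mul] at hswap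
  have hL : ∀ y : sphere (0 : E3) 1, (legendreP n).eval (inner ℝ x (y : E3)) *
      sphHarmProj m f y = (2 * m + 1) / (4 * π) * ∫ w : sphere (0 : E3) 1,
        (legendreP n).eval (inner ℝ x (y : E3)) *
        (legendreP m).eval (inner ℝ (y : E3) (w : E3)) * f w ∂σ₂ := fun y => by
    simp only [mul_assoc]
    rw [integral_const_mul, sphHarmProj]
    ring
  rw [sphHarmProj]
  simp only [hL]
  rw [integral_const_mul, hswap]
  split_ifs with h
  · subst h
    rw [sphHarmProj]
    field_simp
  · simp

/-- The multiplier of the gradiometry operator on spherical harmonics of degree `m`. -/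
noncomputable def gradSymbol (R : ℝ) (m : ℕ) : ℝ := ((m : ℝ) + 1) * ((m : ℝ) + 2) / R ^ (m + 3)

/-- An `R`-dependent constant dominating tails of the gradiometry series. -/
noncomputable def gradTailConst (R : ℝ) : ℝ :=
  ∑' j : ℕ, 2 * ((j : ℝ) + 1) ^ 2 * ((j : ℝ) + 2) / R ^ j

lemma gradSymbol_nonneg {R : ℝ} (hR : 1 < R) (m : ℕ) : 0 ≤ gradSymbol R m := by
  unfold gradSymbol
  positivity

lemma summable_gradTailConst {R : ℝ} (hR : 1 < R) :
    Summable fun j : ℕ => 2 * ((j : ℝ) + 1) ^ 2 * ((j : ℝ) + 2) / R ^ j := by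
  have hr : ‖R⁻¹‖ < 1 := by
    rw [norm_inv, Real.norm_eq_abs, abs_of_pos (by linarith)]
    exact inv_lt_one_of_one_lt₀ hR
  have h := fun k : ℕ => summable_pow_mul_geometric_of_norm_lt_one k hr
  refine ((((h 3).mul_left 2).add ((h 2).mul_left 8)).add
    (((h 1).mul_left 10).add ((h 0).mul_left 4))).congr fun j => ?_
  rw [inv_pow, div_eq_mul_inv]
  ring

lemma gradSymbol_mul_le {R : ℝ} (hR : 1 < R) (M j : ℕ) :
    gradSymbol R (M + j) * (2 * ((M + j : ℕ) : ℝ) + 1) ≤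
      ((M : ℝ) + 1) ^ 3 / R ^ M * (2 * ((j : ℝ) + 1) ^ 2 * ((j : ℝ) + 2) / R ^ j) := by
  have hM : (0 : ℝ) ≤ M := M.cast_nonneg
  have hj : (0 : ℝ) ≤ j := j.cast_nonneg
  have hMj : (0 : ℝ) ≤ M * j := mul_nonneg hM hj
  have hR0 : 0 < R := by linarith
  have h1 : (M : ℝ) + j + 1 ≤ (M + 1) * (j + 1) := by linarith
  have h2 : (M : ℝ) + j + 2 ≤ (M + 1) * (j + 2) := by linarith
  have h3 : 2 * ((M : ℝ) + j) + 1 ≤ (M + 1) * (2 * (j + 1)) := by linarith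
  have hpow : R ^ M * R ^ j ≤ R ^ (M + j + 3) := by
    rw [← pow_add]
    exact pow_le_pow_right₀ hR.le (by omega)
  rw [gradSymbol, div_mul_eq_mul_div, div_mul_div_comm]
  refine div_le_div₀ (by positivity) ?_ (by positivity) hpow
  push_cast
  calc _ ≤ ((M : ℝ) + 1) * (j + 1) * ((M + 1) * (j + 2)) * ((M + 1) * (2 * (j + 1))) := by
        gcongr
    _ = _ := by ring

lemma summable_gradSymbol_mul {R : ℝ} (hR : 1 < R) :
    Summable fun m : ℕ => gradSymbol R m * (2 * (m : ℝ) + 1) := by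
  refine Summable.of_nonneg_of_le
    (fun m => mul_nonneg (gradSymbol_nonneg hR m) (by positivity)) (fun m => ?_)
    ((summable_gradTailConst hR).mul_left (((0 : ℕ) + 1 : ℝ) ^ 3 / R ^ 0))
  simpa using gradSymbol_mul_le hR 0 m

lemma tsum_gradSymbol_mul_le {R : ℝ} (hR : 1 < R) (M : ℕ) :
    ∑' j : ℕ, gradSymbol R (M + j) * (2 * ((M + j : ℕ) : ℝ) + 1) ≤
      ((M : ℝ) + 1) ^ 3 / R ^ M * gradTailConst R := by
  rw [gradTailConst, ← tsum_mul_left]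
  refine Summable.tsum_le_tsum (gradSymbol_mul_le hR M) ?_
    ((summable_gradTailConst hR).mul_left _)
  have h := (summable_nat_add_iff M).2 (summable_gradSymbol_mul hR)
  simpa only [add_comm _ M] using h

lemma gradOp_eq (R : ℝ) (x : E3) :
    gradOp R f x = ∑' m : ℕ, gradSymbol R m * sphHarmProj m f x := rfl

lemma abs_gradSymbol_mul_sphHarmProj_le {R : ℝ} (hR : 1 < R)
    (hf : Integrable (fun y : sphere (0 : E3) 1 => f y) σ₂) (m : ℕ) {x : E3} (hx : ‖x‖ = 1) :
    |gradSymbol R m * sphHarmProj m f x| ≤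
      gradSymbol R m * (2 * m + 1) * ((∫ y : sphere (0 : E3) 1, |f y| ∂σ₂) / (4 * π)) := by
  rw [abs_mul, abs_of_nonneg (gradSymbol_nonneg hR m)]
  calc _ ≤ gradSymbol R m * ((2 * m + 1) / (4 * π) * ∫ y : sphere (0 : E3) 1, |f y| ∂σ₂) :=
        mul_le_mul_of_nonneg_left (abs_sphHarmProj_le hf m hx) (gradSymbol_nonneg hR m)
    _ = _ := by ring

lemma continuous_gradOp {R : ℝ} (hR : 1 < R)
    (hf : Integrable (fun y : sphere (0 : E3) 1 => f y) σ₂) :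
    Continuous fun x : sphere (0 : E3) 1 => gradOp R f x :=
  continuous_tsum (fun m => (continuous_sphHarmProj hf m).const_mul (gradSymbol R m))
    ((summable_gradSymbol_mul hR).mul_right _)
    fun m x => abs_gradSymbol_mul_sphHarmProj_le hR hf m (norm_eq_of_mem_sphere x)

/-- The gradiometry operator acts on spherical harmonics by its multiplier. -/
theorem sphHarmProj_gradOp {R : ℝ} (hR : 1 < R)
    (hf : Integrable (fun y : sphere (0 : E3) 1 => f y) σ₂) (n : ℕ) {x : E3} (hx : ‖x‖ = 1) :
    sphHarmProj n (gradOp R f) x = gradSymbol R n * sphHarmProj n f x := by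
  set A := (∫ y : sphere (0 : E3) 1, |f y| ∂σ₂) / (4 * π)
  let F : ℕ → sphere (0 : E3) 1 → ℝ := fun m y =>
    (legendreP n).eval (inner ℝ x (y : E3)) * (gradSymbol R m * sphHarmProj m f y)
  have hFc : ∀ m, Continuous (F m) := fun m =>
    (continuous_eval_inner _ _).mul ((continuous_sphHarmProj hf m).const_mul _)
  have hFle : ∀ m y, ‖F m y‖ ≤ gradSymbol R m * (2 * m + 1) * A := fun m y => by
    rw [Real.norm_eq_abs, abs_mul]
    exact (mul_le_of_le_one_left (abs_nonneg _) (abs_legendreP_inner_le_one x y hx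
      (norm_eq_of_mem_sphere y) n)).trans
      (abs_gradSymbol_mul_sphHarmProj_le hR hf m (norm_eq_of_mem_sphere y))
  have hsum := hasSum_integral_of_summable_integral_norm (μ := σ₂)
    (fun m => integrable_sphere_of_continuous (hFc m)) (by
      refine Summable.of_nonneg_of_le (fun m => integral_nonneg fun y => norm_nonneg _)
        (fun m => ?_) (((summable_gradSymbol_mul hR).mul_right A).mul_left (Measure.real σ₂ univ))
      calc _ ≤ ∫ _ : sphere (0 : E3) 1, gradSymbol R m * (2 * m + 1) * A ∂σ₂ :=
            integral_mono (integrable_sphere_of_continuous (hFc m)).norm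
              (integrable_const _) (hFle m)
        _ = _ := by rw [integral_const, smul_eq_mul])
  have hterm : ∀ m, (2 * (n : ℝ) + 1) / (4 * π) * ∫ y, F m y ∂σ₂ =
      gradSymbol R m * if n = m then sphHarmProj n f x else 0 := fun m => by
    rw [← sphHarmProj_sphHarmProj hf n m hx, sphHarmProj]
    simp only [F, mul_left_comm _ (gradSymbol R m)]
    rw [integral_const_mul]
    ring
  have hsum' := hsum.mul_left ((2 * (n : ℝ) + 1) / (4 * π))
  simp only [hterm] at hsum'
  have hsingle : HasSum (fun m => gradSymbol R m * if n = m then sphHarmProj n f x else 0)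
      (gradSymbol R n * sphHarmProj n f x) := by
    have h := hasSum_single (f := fun m => gradSymbol R m *
      if n = m then sphHarmProj n f x else 0) n fun m hm => by simp [hm.symm]
    simpa using h
  rw [← hsum'.unique hsingle, sphHarmProj]
  simp only [F, tsum_mul_left]
  rfl

/-- Splitting the gradiometry series at degree `M`. -/
theorem abs_gradOp_le {R : ℝ} (hR : 1 < R)
    (hf : Integrable (fun y : sphere (0 : E3) 1 => f y) σ₂) (M : ℕ) {x : E3} (hx : ‖x‖ = 1) :
    |gradOp R f x| ≤
      ((M : ℝ) + 1) ^ 3 / R ^ M * gradTailConst R * (∫ y : sphere (0 : E3) 1, |f y| ∂σ₂) +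
        (M : ℝ) ^ 2 / (4 * π) * ∫ y : sphere (0 : E3) 1, |gradOp R f y| ∂σ₂ := by
  set A := ∫ y : sphere (0 : E3) 1, |f y| ∂σ₂ with hA
  have hA0 : 0 ≤ A := integral_nonneg fun y => abs_nonneg _
  set B := ∫ y : sphere (0 : E3) 1, |gradOp R f y| ∂σ₂
  have hbound := fun m => abs_gradSymbol_mul_sphHarmProj_le hR hf m hx
  have hmaj : Summable fun m : ℕ => gradSymbol R m * (2 * (m : ℝ) + 1) * (A / (4 * π)) :=
    (summable_gradSymbol_mul hR).mul_right _
  have hs : Summable fun m => gradSymbol R m * sphHarmProj m f x :=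
    Summable.of_norm_bounded hmaj hbound
  have hg := integrable_sphere_of_continuous (continuous_gradOp hR hf)
  rw [gradOp_eq, ← hs.sum_add_tsum_nat_add M, add_comm]
  refine (abs_add_le _ _).trans (add_le_add ?_ ?_)
  · have htail : Summable fun j : ℕ =>
        gradSymbol R (j + M) * (2 * ((j + M : ℕ) : ℝ) + 1) * (A / (4 * π)) :=
      (summable_nat_add_iff M).2 hmaj
    have h1 := tsum_of_norm_bounded
      (f := fun j => gradSymbol R (j + M) * sphHarmProj (j + M) f x) htail.hasSum fun j => hbound (j + M)
    rw [tsum_mul_right] at h1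
    simp only [add_comm _ M] at h1 ⊢
    have hD := tsum_gradSymbol_mul_le hR M
    have hnonneg : 0 ≤ ((M : ℝ) + 1) ^ 3 / R ^ M * gradTailConst R := by
      refine le_trans (tsum_nonneg fun j => ?_) hD
      exact mul_nonneg (gradSymbol_nonneg hR _) (by positivity)
    refine h1.trans ((mul_le_mul_of_nonneg_right hD (by positivity)).trans ?_)
    refine mul_le_mul_of_nonneg_left (div_le_self hA0 ?_) hnonneg
    linarith [Real.pi_gt_three]
  · calc _ = |∑ m ∈ Finset.range M, sphHarmProj m (gradOp R f) x| := by
          simp only [sphHarmProj_gradOp hR hf _ hx]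
      _ ≤ ∑ m ∈ Finset.range M, |sphHarmProj m (gradOp R f) x| := Finset.abs_sum_le_sum_abs _ _
      _ ≤ ∑ m ∈ Finset.range M, (2 * (m : ℝ) + 1) / (4 * π) * B :=
          Finset.sum_le_sum fun m _ => abs_sphHarmProj_le hg m hx
      _ = _ := by
          rw [← Finset.sum_mul, ← Finset.sum_div]
          congr 2
          induction M with
          | zero => simp
          | succ k ih =>
            rw [Finset.sum_range_succ, ih]
            push_cast
            ring

end Gradiometry

section Interpolation

lemma integral_abs_eq_toReal_eLpNorm_one {α : Type*} [MeasurableSpace α] {μ : Measure α}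
    {g : α → ℝ} (hg : AEStronglyMeasurable g μ) :
    ∫ y, |g y| ∂μ = (eLpNorm g 1 μ).toReal := by
  rw [eLpNorm_one_eq_lintegral_enorm, ← integral_norm_eq_lintegral_enorm hg]
  rfl

lemma integral_abs_le_toReal_eLpNorm_two {α : Type*} [MeasurableSpace α] {μ : Measure α}
    [IsFiniteMeasure μ] {g : α → ℝ} (hg : MemLp g 2 μ) :
    ∫ y, |g y| ∂μ ≤ √(μ.real Set.univ) * (eLpNorm g 2 μ).toReal := by
  rw [integral_abs_eq_toReal_eLpNorm_one hg.aestronglyMeasurable]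
  have h := eLpNorm_le_eLpNorm_mul_rpow_measure_univ (p := 1) (q := 2) (μ := μ)
    one_le_two hg.aestronglyMeasurable
  have hfin : μ Set.univ ^ (1 / (1 : ℝ≥0∞).toReal - 1 / (2 : ℝ≥0∞).toReal) ≠ ∞ :=
    ENNReal.rpow_ne_top_of_nonneg (by norm_num) (measure_ne_top μ _)
  refine (ENNReal.toReal_mono (ENNReal.mul_ne_top hg.eLpNorm_ne_top hfin) h).trans_eq ?_
  rw [ENNReal.toReal_mul, ← ENNReal.toReal_rpow, mul_comm, Real.sqrt_eq_rpow]
  norm_num [Measure.real]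

/-- Elementary estimate used to trade the degree cut-off `M ≈ s` for powers of `s`. -/
lemma floor_cubed_div_pow_le {R s : ℝ} (hR : 1 < R) (hs : 1 ≤ s) :
    ((⌊s⌋₊ : ℝ) + 1) ^ 3 / R ^ ⌊s⌋₊ ≤ 8 * s ^ 3 * R ^ 5 * R ^ (-s - 4) := by
  have hR0 : 0 < R := by linarith
  have hfl : (⌊s⌋₊ : ℝ) ≤ s := Nat.floor_le (by linarith)
  have hlt : s < ⌊s⌋₊ + 1 := Nat.lt_floor_add_one s
  have hnum : ((⌊s⌋₊ : ℝ) + 1) ^ 3 ≤ 8 * s ^ 3 := by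
    calc ((⌊s⌋₊ : ℝ) + 1) ^ 3 ≤ (2 * s) ^ 3 := by gcongr; linarith
      _ = 8 * s ^ 3 := by ring
  have hpow : (R ^ ⌊s⌋₊)⁻¹ ≤ R ^ 5 * R ^ (-s - 4) := by
    rw [← Real.rpow_natCast, ← Real.rpow_neg hR0.le, ← Real.rpow_natCast R 5,
      ← Real.rpow_add hR0]
    refine Real.rpow_le_rpow_of_exponent_le hR.le ?_
    push_cast
    linarith
  calc _ = ((⌊s⌋₊ : ℝ) + 1) ^ 3 * (R ^ ⌊s⌋₊)⁻¹ := div_eq_mul_inv _ _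
    _ ≤ 8 * s ^ 3 * (R ^ 5 * R ^ (-s - 4)) := by gcongr
    _ = _ := by ring

end Interpolation

/-- `L^∞`-`L¹` interpolation inequality for the satellite gradiometry
operator (Lemma 4.3, part 2 / Assumption 2.4): there are `δ₀ > 0` (possibly depending on `R`)
and `C > 0` independent of `R` and `δ` such that
`‖Tf‖_{L^∞(S²)} ≤ C δ^{-5/2} R^{-√(4π/δ)-4} ‖f‖_{L²(S²)} + (1/δ) ‖Tf‖_{L¹(S²)}`
for all `0 < δ ≤ δ₀` and all `f ∈ L²(S²)`. -/
theorem gradiometry_interpolation_inequality :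
    ∃ C : ℝ, 0 < C ∧
      ∀ R : ℝ, 1 < R →
      ∃ δ₀ : ℝ, 0 < δ₀ ∧
        ∀ δ : ℝ, 0 < δ → δ ≤ δ₀ →
        ∀ f : EuclideanSpace ℝ (Fin 3) → ℝ,
          MemLp (fun y : Metric.sphere (0 : EuclideanSpace ℝ (Fin 3)) 1 =>
              f (y : EuclideanSpace ℝ (Fin 3))) 2
            (volume : Measure (EuclideanSpace ℝ (Fin 3))).toSphere →
        ∀ x ∈ Metric.sphere (0 : EuclideanSpace ℝ (Fin 3)) 1,
          |gradOp R f x|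
            ≤ C * δ ^ (-(5 : ℝ) / 2) * R ^ (-Real.sqrt (4 * π / δ) - 4) *
                (eLpNorm (fun y : Metric.sphere (0 : EuclideanSpace ℝ (Fin 3)) 1 =>
                    f (y : EuclideanSpace ℝ (Fin 3))) 2
                  (volume : Measure (EuclideanSpace ℝ (Fin 3))).toSphere).toReal
              + (1 / δ) *
                  (eLpNorm (fun y : Metric.sphere (0 : EuclideanSpace ℝ (Fin 3)) 1 =>
                      gradOp R f (y : EuclideanSpace ℝ (Fin 3))) 1
                    (volume : Measure (EuclideanSpace ℝ (Fin 3))).toSphere).toReal := by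
  refine ⟨(4 * π) ^ ((5 : ℝ) / 2), by positivity, fun R hR => ?_⟩
  set σ : Measure (Metric.sphere (0 : EuclideanSpace ℝ (Fin 3)) 1) :=
    (volume : Measure (EuclideanSpace ℝ (Fin 3))).toSphere
  have hR0 : 0 < R := by linarith
  have hD : 0 ≤ gradTailConst R := tsum_nonneg fun j => by positivity
  set K : ℝ := 8 * R ^ 5 * gradTailConst R * √(σ.real Set.univ)
  have hK : 0 ≤ K := by positivity
  refine ⟨min 1 (4 * π / (K + 1)), by positivity, fun δ hδ hδ₀ f hf x hx => ?_⟩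
  have hδ1 : δ ≤ 1 := hδ₀.trans (min_le_left _ _)
  have hδK : K ≤ 4 * π / δ := by
    have h := hδ₀.trans (min_le_right _ _)
    rw [le_div_iff₀ (by positivity)] at h ⊢
    linarith
  set s : ℝ := √(4 * π / δ) with hs
  have hs2 : s ^ 2 = 4 * π / δ := Real.sq_sqrt (by positivity)
  have hs1 : 1 ≤ s := by
    rw [hs, Real.one_le_sqrt, le_div_iff₀ hδ]
    linarith [Real.pi_gt_three]
  have hs5 : (4 * π) ^ ((5 : ℝ) / 2) * δ ^ (-(5 : ℝ) / 2) = s ^ 5 := by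
    rw [neg_div, Real.rpow_neg hδ.le, ← div_eq_mul_inv,
      ← Real.div_rpow (by positivity) hδ.le, hs, Real.sqrt_eq_rpow, ← Real.rpow_natCast,
      ← Real.rpow_mul (by positivity)]
    norm_num
  have hfi : Integrable (fun y : Metric.sphere (0 : EuclideanSpace ℝ (Fin 3)) 1 => f y) σ :=
    hf.integrable one_le_two
  have hTc : AEStronglyMeasurable
      (fun y : Metric.sphere (0 : EuclideanSpace ℝ (Fin 3)) 1 => gradOp R f y) σ :=
    (continuous_gradOp hR hfi).aestronglyMeasurable
  refine (abs_gradOp_le hR hfi ⌊s⌋₊ (mem_sphere_zero_iff_norm.1 hx)).trans ?_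
  rw [hs5, ← integral_abs_eq_toReal_eLpNorm_one hTc]
  refine add_le_add ?_ (mul_le_mul_of_nonneg_right ?_ (integral_nonneg fun y => abs_nonneg _))
  · set N := (eLpNorm (fun y : Metric.sphere (0 : EuclideanSpace ℝ (Fin 3)) 1 => f y) 2 σ).toReal
    have hN : 0 ≤ N := ENNReal.toReal_nonneg
    have hE : 0 < R ^ (-s - 4) := Real.rpow_pos_of_pos hR0 _
    calc _ ≤ 8 * s ^ 3 * R ^ 5 * R ^ (-s - 4) * gradTailConst R *
          (√(σ.real Set.univ) * N) := by
          gcongr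
          · exact floor_cubed_div_pow_le hR hs1
          · exact integral_abs_le_toReal_eLpNorm_two hf
      _ = K * (s ^ 3 * R ^ (-s - 4) * N) := by ring
      _ ≤ s ^ 2 * (s ^ 3 * R ^ (-s - 4) * N) := by
          rw [hs2]
          gcongr
      _ = _ := by ring
  · have hfl : (⌊s⌋₊ : ℝ) ≤ s := Nat.floor_le (by linarith)
    calc (⌊s⌋₊ : ℝ) ^ 2 / (4 * π) ≤ s ^ 2 / (4 * π) := by gcongr
      _ = 1 / δ := by
          rw [hs2]
          field_simp
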